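/- Let F be a finite union-closed family of finite sets with ∅ ∈ F and let U ∈ J(F). Let G = {V ∈ J(F) : V ∩ U ≠ ∅}. Suppose that: (i) |U| = 2, (ii) every member of G has cardinality 1 or 2, and (iii) there is a family G' ⊆ J(F) all of whose members have cardinality exactly 2 such that every V ∈ G with |V| = 2 satisfies V ∈ G' and d_{G'}(V) ≥ d_{G'}(U). Then (F, U) has the density property: 2·|{A ∈ F : U ⊆ A}| ≤ |F|. -/

import Mathlib

open Finset

/-- `F` is union-closed. -/
def UnionClosed {α : Type*} [DecidableEq α] (F : Finset (Finset α)) : Prop :=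
  ∀ A ∈ F, ∀ B ∈ F, A ∪ B ∈ F

/-- The generators `J(F)`: nonempty members of `F` that are not the union of the
members of `F` properly contained in them. -/
def gens {α : Type*} [DecidableEq α] (F : Finset (Finset α)) : Finset (Finset α) :=
  F.filter (fun U => U.Nonempty ∧ (F.filter (fun A => A ⊂ U)).sup id ≠ U)

/-- The closure `π_F(X)`: the union of all members of `F` contained in `X`. -/
def piF {α : Type*} [DecidableEq α] (F : Finset (Finset α)) (X : Finset α) : Finset α :=
  (F.filter (fun A => A ⊆ X)).sup id

/-- `F ∨ H = {A ∪ B : A ∈ F, B ∈ H}`. -/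
def famJoin {α : Type*} [DecidableEq α] (F H : Finset (Finset α)) : Finset (Finset α) :=
  (F ×ˢ H).image (fun p => p.1 ∪ p.2)

/-- `F'` is an extension of `(F, U)`: `F' = F ∨ H` for some nonempty union-closed
family `H` with `(⋃ H) ∩ U = ∅`. -/
def IsExtension {α : Type*} [DecidableEq α] (F : Finset (Finset α)) (U : Finset α)
    (F' : Finset (Finset α)) : Prop :=
  ∃ H : Finset (Finset α), H.Nonempty ∧ UnionClosed H ∧ (H.sup id) ∩ U = ∅ ∧ F' = famJoin F H

/-- The restriction of `F` away from `U`: `F_{∖U} = {A ∖ U : A ∈ F}`. -/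
def resAway {α : Type*} [DecidableEq α] (F : Finset (Finset α)) (U : Finset α) :
    Finset (Finset α) :=
  F.image (fun A => A \ U)

/-- `E_{F,U}(X)`: the subsets `Y ⊆ U` with `π_F(X ∪ Y) ∩ U = Y` and
`π_F(X ∪ Y) ⊇ π_F(X ∪ U) \ U`. -/
def Efam {α : Type*} [DecidableEq α] (F : Finset (Finset α)) (U X : Finset α) :
    Finset (Finset α) :=
  U.powerset.filter (fun Y => piF F (X ∪ Y) ∩ U = Y ∧ piF F (X ∪ U) \ U ⊆ piF F (X ∪ Y))

/-- `μ_{F,F'}(U) = (Σ_{X ∈ F'_{∖U}} |E_{F,U}(X)|) / |F'_{∖U}|`. -/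
def mu {α : Type*} [DecidableEq α] (F : Finset (Finset α)) (U : Finset α)
    (F' : Finset (Finset α)) : ℚ :=
  (∑ X ∈ resAway F' U, ((Efam F U X).card : ℚ)) / ((resAway F' U).card : ℚ)

/-- The union-closed family generated by `G` (all unions of subfamilies of `G`;
it contains `∅` as the empty union). -/
def genUC {α : Type*} [DecidableEq α] (G : Finset (Finset α)) : Finset (Finset α) :=
  G.powerset.image (fun S => S.sup id)

/-- The lattice neighborhood `𝒩_F(U)`: the union-closed family generated by `{∅}`
together with the generators of `F` meeting `U`. -/
def latNbhd {α : Type*} [DecidableEq α] (F : Finset (Finset α)) (U : Finset α) :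
    Finset (Finset α) :=
  genUC ((gens F).filter (fun V => (V ∩ U).Nonempty))

/-- The third lattice neighborhood `𝒩³_F(U) = 𝒩_F(⋃ 𝒩_F(U))`. -/
def latNbhd3 {α : Type*} [DecidableEq α] (F : Finset (Finset α)) (U : Finset α) :
    Finset (Finset α) :=
  latNbhd F ((latNbhd F U).sup id)

/-- The neighborhood `N_F(X) = X ∪ ⋃ {V ∈ J(F) : V ∩ X ≠ ∅}`. -/
def nbhd {α : Type*} [DecidableEq α] (F : Finset (Finset α)) (X : Finset α) : Finset α :=
  X ∪ ((gens F).filter (fun V => (V ∩ X).Nonempty)).sup id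

/-- `H` is a filter of `2^S`: a nonempty family of subsets of `S` closed upward in `S`. -/
def IsFilterOn {α : Type*} [DecidableEq α] (S : Finset α) (H : Finset (Finset α)) : Prop :=
  H.Nonempty ∧ (∀ X ∈ H, X ⊆ S) ∧ ∀ X ∈ H, ∀ Y, X ⊆ Y → Y ⊆ S → Y ∈ H

/-- `F'` minimizes `μ` in `D` (among extensions of `(F, U)` with union inside `D`). -/
def MinimizesMu {α : Type*} [DecidableEq α] (F : Finset (Finset α)) (U D : Finset α)
    (F' : Finset (Finset α)) : Prop :=
  F'.sup id ⊆ D ∧ ∀ F'', IsExtension F U F'' → F''.sup id ⊆ D → mu F U F' ≤ mu F U F''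

/-- The degree of `U` in the graph `G`: the number of members of `G` other than `U`
meeting `U`. -/
def degG {α : Type*} [DecidableEq α] (G : Finset (Finset α)) (U : Finset α) : ℕ :=
  (G.filter (fun V => V ≠ U ∧ (V ∩ U).Nonempty)).card

theorem two_pow_mul_le_add (p q : ℕ) :
    2 ^ (p * q) ≤ (2 ^ q - 1) ^ p + (2 ^ p - 1) ^ q := by
  classical
  let R : Finset (Fin p → Fin q → Bool) :=
    Fintype.piFinset fun _ => univ.erase fun _ => false
  let C : Finset (Fin q → Fin p → Bool) :=
    Fintype.piFinset fun _ => univ.erase fun _ => true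
  have hR : #R = (2 ^ q - 1) ^ p := by simp [R, card_erase_of_mem]
  have hC : #C = (2 ^ p - 1) ^ q := by simp [C, card_erase_of_mem]
  have hcover : (univ : Finset (Fin p → Fin q → Bool)) ⊆
      R ∪ C.image (fun M i j => M j i) := by
    intro M _
    by_cases h : M ∈ R
    · exact mem_union_left _ h
    · refine mem_union_right _ (mem_image.2 ⟨fun j i => M i j, ?_, rfl⟩)
      simp only [R, Fintype.mem_piFinset, mem_erase, mem_univ, and_true, not_forall,
        not_not] at h
      obtain ⟨i, hi⟩ := h
      simp only [C, Fintype.mem_piFinset, mem_erase, mem_univ, and_true]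
      intro j hj
      have h1 := congrFun hi j
      have h2 := congrFun hj i
      simp_all
  have h := (card_le_card hcover).trans (card_union_le _ _)
  have h' := card_image_le (s := C) (f := fun M i j => M j i)
  rw [hR] at h
  rw [hC] at h'
  have hu : #(univ : Finset (Fin p → Fin q → Bool)) = 2 ^ (p * q) := by
    simp [card_univ, ← pow_mul, mul_comm]
  omega

theorem card_mul_card_le_two_pow_mul_card_inter {α : Type*} [DecidableEq α]
    {M : Finset α} {𝒜 ℬ : Finset (Finset α)}
    (hA : 𝒜 ⊆ M.powerset) (hB : ℬ ⊆ M.powerset)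
    (hA' : ∀ X ∈ 𝒜, ∀ Y ⊆ M, X ⊆ Y → Y ∈ 𝒜) (hB' : ∀ X ∈ ℬ, ∀ Y ⊆ M, X ⊆ Y → Y ∈ ℬ) :
    #𝒜 * #ℬ ≤ 2 ^ #M * #(𝒜 ∩ ℬ) := by
  refine (le_card_infs_mul_card_sups 𝒜 ℬ).trans (Nat.mul_le_mul ?_ ?_)
  · rw [← card_powerset]
    refine card_le_card fun X hX => ?_
    obtain ⟨A, hA1, B, hB1, rfl⟩ := mem_infs.1 hX
    exact mem_powerset.2 (inter_subset_left.trans (mem_powerset.1 (hA hA1)))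
  · refine card_le_card fun X hX => ?_
    obtain ⟨A, hA1, B, hB1, rfl⟩ := mem_sups.1 hX
    have hM : A ∪ B ⊆ M := union_subset (mem_powerset.1 (hA hA1)) (mem_powerset.1 (hB hB1))
    exact mem_inter.2 ⟨hA' A hA1 _ hM subset_union_left, hB' B hB1 _ hM subset_union_right⟩

/-- Subsets of `M` meeting `N x` for every `x ∈ P`. -/
def hitting {α : Type*} [DecidableEq α] (M P : Finset α) (N : α → Finset α) : Finset (Finset α) :=
  M.powerset.filter fun W => ∀ x ∈ P, (N x ∩ W).Nonempty

theorem mem_hitting_of_subset {α : Type*} [DecidableEq α]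
    {M P : Finset α} {N : α → Finset α} {X Y : Finset α}
    (hX : X ∈ hitting M P N) (hY : Y ⊆ M) (hXY : X ⊆ Y) : Y ∈ hitting M P N := by
  simp only [hitting, mem_filter, mem_powerset] at hX ⊢
  exact ⟨hY, fun x hx => (hX.2 x hx).mono (inter_subset_inter_left hXY)⟩

theorem two_pow_sub_one_mul_le_card_hitting_singleton {α : Type*} [DecidableEq α]
    {M : Finset α} {N : α → Finset α} {x : α}
    {q : ℕ} (hM : N x ⊆ M) (hq : q ≤ #(N x)) :
    (2 ^ q - 1) * 2 ^ #M ≤ 2 ^ q * #(hitting M {x} N) := by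
  have hsplit : #(hitting M {x} N) + #((M \ N x).powerset) = 2 ^ #M := by
    rw [← card_powerset, ← card_filter_add_card_filter_not (s := M.powerset)
      (fun W => ∀ y ∈ ({x} : Finset α), (N y ∩ W).Nonempty)]
    congr 2
    ext W
    simp only [mem_powerset, subset_sdiff, mem_filter, mem_singleton, forall_eq,
      not_nonempty_iff_eq_empty, ← disjoint_iff_inter_eq_empty, disjoint_comm]
  rw [card_powerset, card_sdiff_of_subset hM] at hsplit
  have hle : 2 ^ q * 2 ^ (#M - #(N x)) ≤ 2 ^ #M := by
    rw [← pow_add]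
    exact Nat.pow_le_pow_right (by norm_num) (by have := card_le_card hM; omega)
  rw [Nat.sub_mul, Nat.sub_le_iff_le_add, ← hsplit]
  rw [← hsplit] at hle
  nlinarith

theorem two_pow_sub_one_pow_le_card_hitting {α : Type*} [DecidableEq α]
    {M P : Finset α} {N : α → Finset α} {q : ℕ}
    (hM : ∀ x ∈ P, N x ⊆ M) (hq : ∀ x ∈ P, q ≤ #(N x)) :
    (2 ^ q - 1) ^ #P * 2 ^ #M ≤ 2 ^ (#P * q) * #(hitting M P N) := by
  induction P using Finset.induction_on with
  | empty => simp [hitting]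
  | insert x P hx ih =>
    have ih := ih (fun y hy => hM y (mem_insert_of_mem hy))
      (fun y hy => hq y (mem_insert_of_mem hy))
    have hs := two_pow_sub_one_mul_le_card_hitting_singleton (hM x (mem_insert_self _ _))
      (hq x (mem_insert_self _ _))
    have hH := card_mul_card_le_two_pow_mul_card_inter (M := M) (𝒜 := hitting M {x} N)
      (ℬ := hitting M P N) (filter_subset _ _) (filter_subset _ _)
      (fun X hX Y hY h => mem_hitting_of_subset hX hY h)
      (fun X hX Y hY h => mem_hitting_of_subset hX hY h)
    have hI : hitting M {x} N ∩ hitting M P N = hitting M (insert x P) N := by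
      ext W
      simp only [hitting, mem_inter, mem_filter, mem_singleton, forall_eq, forall_mem_insert]
      tauto
    rw [hI] at hH
    rw [card_insert_of_notMem hx, pow_succ]
    have hpos : 0 < 2 ^ #M := by positivity
    refine Nat.le_of_mul_le_mul_right ?_ hpos
    calc (2 ^ q - 1) ^ #P * (2 ^ q - 1) * 2 ^ #M * 2 ^ #M
        = ((2 ^ q - 1) ^ #P * 2 ^ #M) * ((2 ^ q - 1) * 2 ^ #M) := by ring
      _ ≤ (2 ^ (#P * q) * #(hitting M P N)) * (2 ^ q * #(hitting M {x} N)) :=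
          Nat.mul_le_mul ih hs
      _ = 2 ^ (#P * q) * 2 ^ q * (#(hitting M {x} N) * #(hitting M P N)) := by ring
      _ ≤ 2 ^ (#P * q) * 2 ^ q * (2 ^ #M * #(hitting M (insert x P) N)) :=
          Nat.mul_le_mul_left _ hH
      _ = 2 ^ ((#P + 1) * q) * #(hitting M (insert x P) N) * 2 ^ #M := by ring

theorem two_pow_le_card_hitting_add_card_hitting {α : Type*} [DecidableEq α]
    {M P Q : Finset α} {N : α → Finset α}
    (hMP : ∀ x ∈ P, N x ⊆ M) (hMQ : ∀ y ∈ Q, N y ⊆ M)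
    (hP : ∀ x ∈ P, #Q ≤ #(N x)) (hQ : ∀ y ∈ Q, #P ≤ #(N y)) :
    2 ^ #M ≤ #(hitting M P N) + #(hitting M Q N) := by
  have h1 := two_pow_sub_one_pow_le_card_hitting hMP hP
  have h2 := two_pow_sub_one_pow_le_card_hitting hMQ hQ
  have h3 := Nat.mul_le_mul_right (2 ^ #M) (two_pow_mul_le_add #P #Q)
  rw [mul_comm #Q #P] at h2
  have hpos : 0 < 2 ^ (#P * #Q) := by positivity
  refine Nat.le_of_mul_le_mul_left ?_ hpos
  linarith

/-- Coordinates that can be added to `X`: `D` and the neighbours of `X ∩ D`. -/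
def active {α : Type*} [DecidableEq α]
    (D : Finset α) (N : α → Finset α) (X : Finset α) : Finset α :=
  D ∪ (X ∩ D).biUnion N

/-- The set agreeing with `X` on `K` and with `W` off `K`. -/
def splice {α : Type*} [DecidableEq α] (K X W : Finset α) : Finset α := X ∩ K ∪ W \ K

theorem mem_splice {α : Type*} [DecidableEq α] {K X W : Finset α} {a : α} :
    a ∈ splice K X W ↔ a ∈ X ∧ a ∈ K ∨ a ∈ W ∧ a ∉ K := by
  simp [splice]

theorem sum_splice_le_sum_splice_insert {α : Type*} [DecidableEq α]
    {M K : Finset α} {i : α} {Ω : Finset (Finset α)}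
    {act : Finset α → Finset α} {f : Finset α → ℤ} (hf : Monotone f) (hiM : i ∈ M) (hiK : i ∉ K)
    (hact : ∀ X ∈ Ω, i ∈ act X → insert i X ∈ Ω ∧ i ∈ act (insert i X) ∧
      K ∩ act (insert i X) = K ∩ act X) :
    ∑ X ∈ Ω, ∑ W ∈ M.powerset, f (splice (K ∩ act X) X W) ≤
      ∑ X ∈ Ω, ∑ W ∈ M.powerset, f (splice (insert i K ∩ act X) X W) := by
  have hM : M = insert i (M.erase i) := (insert_erase hiM).symm
  have hsum : ∀ g : Finset α → ℤ, ∑ W ∈ M.powerset, g W =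
      ∑ W ∈ (M.erase i).powerset, (g W + g (insert i W)) := by
    intro g
    rw [hM, sum_powerset_insert (by simp), ← sum_add_distrib]
    simp
  let δ : Finset α → ℤ := fun X => ∑ W ∈ (M.erase i).powerset,
    (f (insert i (splice (K ∩ act X) X W)) - f (splice (K ∩ act X) X W))
  have hδ : ∀ X, 0 ≤ δ X := fun X =>
    sum_nonneg fun W _ => sub_nonneg.2 (hf (subset_insert _ _))
  have hdiff : ∀ X, ∑ W ∈ M.powerset, f (splice (insert i K ∩ act X) X W) -
      ∑ W ∈ M.powerset, f (splice (K ∩ act X) X W) =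
      if i ∈ act X then (if i ∈ X then δ X else - δ X) else 0 := by
    intro X
    split_ifs with ha hX
    · rw [hsum, hsum, ← sum_sub_distrib]
      refine sum_congr rfl fun W hW => ?_
      have hiW : i ∉ W := fun h => by simpa using mem_powerset.1 hW h
      have e1 : splice (insert i K ∩ act X) X W = insert i (splice (K ∩ act X) X W) := by
        grind [splice]
      have e2 : splice (insert i K ∩ act X) X (insert i W) =
          insert i (splice (K ∩ act X) X W) := by
        grind [splice]
      have e3 : splice (K ∩ act X) X (insert i W) = insert i (splice (K ∩ act X) X W) := by
        grind [splice]
      rw [e1, e2, e3]; ring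
    · rw [hsum, hsum, ← sum_sub_distrib, ← sum_neg_distrib]
      refine sum_congr rfl fun W hW => ?_
      have hiW : i ∉ W := fun h => by simpa using mem_powerset.1 hW h
      have e1 : splice (insert i K ∩ act X) X W = splice (K ∩ act X) X W := by
        grind [splice]
      have e2 : splice (insert i K ∩ act X) X (insert i W) = splice (K ∩ act X) X W := by
        grind [splice]
      have e3 : splice (K ∩ act X) X (insert i W) = insert i (splice (K ∩ act X) X W) := by
        grind [splice]
      rw [e1, e2, e3]; ring
    · rw [insert_inter_of_notMem ha, sub_self]
  rw [← sub_nonneg, ← sum_sub_distrib, sum_congr rfl fun X _ => hdiff X, ← sum_filter,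
    sum_ite, sum_neg_distrib, ← sub_eq_add_neg, sub_nonneg]
  have hinj : Set.InjOn (insert i) ((Ω.filter (i ∈ act ·)).filter (i ∉ ·) : Set (Finset α)) := by
    intro X hX Y hY h
    simp only [SetLike.mem_coe, mem_filter] at hX hY
    rw [← erase_insert hX.2, ← erase_insert hY.2]
    exact congrArg (erase · i) h
  calc ∑ X ∈ (Ω.filter (i ∈ act ·)).filter (i ∉ ·), δ X
      = ∑ X ∈ (Ω.filter (i ∈ act ·)).filter (i ∉ ·), δ (insert i X) := by
        refine sum_congr rfl fun X hX => ?_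
        simp only [mem_filter] at hX
        obtain ⟨-, -, hK⟩ := hact X hX.1.1 hX.1.2
        simp only [δ, hK]
        refine sum_congr rfl fun W _ => ?_
        have e : splice (K ∩ act X) (insert i X) W = splice (K ∩ act X) X W := by
          grind [splice]
        rw [e]
    _ = ∑ X ∈ ((Ω.filter (i ∈ act ·)).filter (i ∉ ·)).image (insert i), δ X :=
        (sum_image hinj).symm
    _ ≤ ∑ X ∈ (Ω.filter (i ∈ act ·)).filter (i ∈ ·), δ X := by
        refine sum_le_sum_of_subset_of_nonneg (fun Y hY => ?_) fun X _ _ => hδ X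
        obtain ⟨X, hX, rfl⟩ := mem_image.1 hY
        simp only [mem_filter] at hX ⊢
        obtain ⟨h1, h2, -⟩ := hact X hX.1.1 hX.1.2
        exact ⟨⟨h1, h2⟩, mem_insert_self _ _⟩

/-- Resampling the inactive coordinates uniformly gives a law dominating the uniform one. -/
theorem card_mul_sum_le_sum_splice_active {α : Type*} [DecidableEq α]
    {D M : Finset α} {N : α → Finset α}
    {Ω : Finset (Finset α)} {f : Finset α → ℤ} (hf : Monotone f) (hDM : D ⊆ M)
    (hD : ∀ X ∈ Ω, ∀ x ∈ D, insert x X ∈ Ω)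
    (hN : ∀ X ∈ Ω, ∀ x ∈ X ∩ D, ∀ z ∈ N x, insert z X ∈ Ω) :
    #Ω * ∑ W ∈ M.powerset, f W ≤
      ∑ X ∈ Ω, ∑ W ∈ M.powerset, f (splice (M ∩ active D N X) X W) := by
  have h0 : (#Ω : ℤ) * ∑ W ∈ M.powerset, f W =
      ∑ X ∈ Ω, ∑ W ∈ M.powerset, f (splice (∅ ∩ active D N X) X W) := by
    simp [splice]
  have h1 : ∀ K ⊆ D, ∑ X ∈ Ω, ∑ W ∈ M.powerset, f (splice (∅ ∩ active D N X) X W) ≤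
      ∑ X ∈ Ω, ∑ W ∈ M.powerset, f (splice (K ∩ active D N X) X W) := by
    intro K
    induction K using Finset.induction_on with
    | empty => intro _; exact le_rfl
    | insert i K hi ih =>
      intro hK
      rw [insert_subset_iff] at hK
      refine (ih hK.2).trans (sum_splice_le_sum_splice_insert hf (hDM hK.1) hi ?_)
      intro X hX _
      refine ⟨hD X hX i hK.1, mem_union_left _ hK.1, ?_⟩
      have : ∀ Y, K ∩ active D N Y = K := fun Y =>
        inter_eq_left.2 (hK.2.trans subset_union_left)
      rw [this, this]
  have h2 : ∀ L ⊆ M, ∑ X ∈ Ω, ∑ W ∈ M.powerset, f (splice (D ∩ active D N X) X W) ≤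
      ∑ X ∈ Ω, ∑ W ∈ M.powerset, f (splice ((L ∪ D) ∩ active D N X) X W) := by
    intro L
    induction L using Finset.induction_on with
    | empty => intro _; rw [empty_union]
    | insert i L hi ih =>
      intro hL
      rw [insert_subset_iff] at hL
      refine (ih hL.2).trans ?_
      rw [insert_union]
      by_cases hiD : i ∈ L ∪ D
      · rw [insert_eq_of_mem hiD]
      refine sum_splice_le_sum_splice_insert hf hL.1 hiD ?_
      intro X hX hiX
      have hiD' : i ∉ D := fun h => hiD (mem_union_right _ h)
      have hact : active D N (insert i X) = active D N X := by
        rw [active, insert_inter_of_notMem hiD', active]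
      rw [hact]
      refine ⟨?_, hiX, rfl⟩
      obtain h | h := mem_union.1 hiX
      · exact absurd h hiD'
      · obtain ⟨x, hx, hz⟩ := mem_biUnion.1 h
        exact hN X hX x hx i hz
  rw [h0]
  refine (h1 D Subset.rfl).trans ((h2 M Subset.rfl).trans ?_)
  rw [union_eq_left.2 hDM]

theorem card_uncovered_le_card_covered {α : Type*} [DecidableEq α]
    {P Q : Finset α} {N : α → Finset α}
    {Ω : Finset (Finset α)} (hP : ∀ x ∈ P, #Q ≤ #(N x)) (hQ : ∀ y ∈ Q, #P ≤ #(N y))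
    (hD : ∀ X ∈ Ω, ∀ x ∈ P ∪ Q, insert x X ∈ Ω)
    (hN : ∀ X ∈ Ω, ∀ x ∈ X ∩ (P ∪ Q), ∀ z ∈ N x, insert z X ∈ Ω) :
    #{X ∈ Ω | (∃ x ∈ X ∩ P, N x ∩ X = ∅) ∧ ∃ y ∈ X ∩ Q, N y ∩ X = ∅} ≤
      #{X ∈ Ω | ∀ x ∈ X ∩ (P ∪ Q), (N x ∩ X).Nonempty} := by
  set D := P ∪ Q with hDdef
  let M := D ∪ D.biUnion N
  have hNM : ∀ x ∈ D, N x ⊆ M := fun x hx =>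
    (subset_biUnion_of_mem N hx).trans subset_union_right
  let ind : Finset α → Finset α → ℤ := fun S W =>
    if ∀ x ∈ S, (N x ∩ W).Nonempty then 1 else 0
  have hind : ∀ S, Monotone (ind S) := by
    intro S V W hVW
    simp only [ind]
    split_ifs with h1 h2 h2
    · exact le_rfl
    · exact absurd (fun x hx => (h1 x hx).mono (inter_subset_inter_left hVW)) h2
    · norm_num
    · exact le_rfl
  let f : Finset α → ℤ := fun W => ind P W + ind Q W - 1
  have hf : Monotone f := fun V W h => by
    have := hind P h; have := hind Q h; simp only [f]; linarith
  have hdom := card_mul_sum_le_sum_splice_active (M := M) hf subset_union_left hD hN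
  have hunif : 0 ≤ ∑ W ∈ M.powerset, f W := by
    have h := two_pow_le_card_hitting_add_card_hitting (M := M) (N := N)
      (fun x hx => hNM x (mem_union_left _ hx)) (fun x hx => hNM x (mem_union_right _ hx)) hP hQ
    have hs : ∀ S, ∑ W ∈ M.powerset, ind S W = #(hitting M S N) := by
      intro S; simp [ind, hitting, sum_boole]
    simp only [f]
    rw [sum_sub_distrib, sum_add_distrib, hs, hs]
    simp only [sum_const, card_powerset, nsmul_eq_mul, mul_one]
    have : ((2 ^ #M : ℕ) : ℤ) ≤ #(hitting M P N) + #(hitting M Q N) := by exact_mod_cast h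
    linarith
  have hnonneg := (mul_nonneg (Nat.cast_nonneg (α := ℤ) #Ω) hunif).trans hdom
  let bad : Finset α → Prop := fun X =>
    (∃ x ∈ X ∩ P, N x ∩ X = ∅) ∧ ∃ y ∈ X ∩ Q, N y ∩ X = ∅
  let good : Finset α → Prop := fun X => ∀ x ∈ X ∩ D, (N x ∩ X).Nonempty
  have hpt : ∀ X W, f (splice (M ∩ active D N X) X W) ≤
      (if good X then (1 : ℤ) else 0) - if bad X then (1 : ℤ) else 0 := by
    intro X W
    have hY : ∀ x ∈ X ∩ D, N x ∩ splice (M ∩ active D N X) X W = N x ∩ X := by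
      intro x hx
      ext z
      simp only [mem_inter, mem_splice]
      refine and_congr_right fun hz => ?_
      have h1 : z ∈ M := hNM x (mem_inter.1 hx).2 hz
      have h2 : z ∈ active D N X := mem_union_right _ (mem_biUnion.2 ⟨x, hx, hz⟩)
      tauto
    set Y := splice (M ∩ active D N X) X W
    have hbad : ∀ S ⊆ D, (∃ x ∈ X ∩ S, N x ∩ X = ∅) → ind S Y = 0 := by
      rintro S hS ⟨x, hx, h⟩
      have hx := mem_inter.1 hx
      refine if_neg fun hall => ?_
      have := hall x hx.2
      rw [hY x (mem_inter.2 ⟨hx.1, hS hx.2⟩), h] at this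
      exact not_nonempty_empty this
    have hle : ∀ S, ind S Y ≤ 1 := by
      intro S; simp only [ind]; split_ifs <;> norm_num
    have hbadgood : bad X → ¬ good X := by
      rintro ⟨⟨x, hx, h⟩, -⟩ hg
      have hx := mem_inter.1 hx
      have := hg x (mem_inter.2 ⟨hx.1, mem_union_left _ hx.2⟩)
      rw [h] at this
      exact not_nonempty_empty this
    have hgood : ¬ good X → ind P Y + ind Q Y ≤ 1 := by
      intro hg
      simp only [good, not_forall, not_nonempty_iff_eq_empty] at hg
      obtain ⟨x, hx, h⟩ := hg
      obtain hxP | hxQ := mem_union.1 (mem_inter.1 hx).2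
      · have := hbad P subset_union_left ⟨x, mem_inter.2 ⟨(mem_inter.1 hx).1, hxP⟩, h⟩
        linarith [hle Q]
      · have := hbad Q subset_union_right ⟨x, mem_inter.2 ⟨(mem_inter.1 hx).1, hxQ⟩, h⟩
        linarith [hle P]
    simp only [f]
    by_cases hb : bad X
    · have h1 := hbad P subset_union_left hb.1
      have h2 := hbad Q subset_union_right hb.2
      rw [if_neg (hbadgood hb), if_pos hb, h1, h2]; norm_num
    · by_cases hg : good X
      · rw [if_pos hg, if_neg hb]; linarith [hle P, hle Q]
      · rw [if_neg hg, if_neg hb]; linarith [hgood hg]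
  have hsum := hnonneg.trans (sum_le_sum fun X _ => sum_le_sum fun W _ => hpt X W)
  simp only [sum_const, ← smul_sum, sum_sub_distrib, sum_boole] at hsum
  rw [nsmul_eq_mul] at hsum
  have hpos : (0 : ℤ) < (#M.powerset : ℕ) := by simp
  have := nonneg_of_mul_nonneg_right hsum hpos
  have h' := sub_nonneg.1 this
  exact_mod_cast h'

theorem exists_mem_gens {α : Type*} [DecidableEq α] {F : Finset (Finset α)} {A : Finset α} {a : α}
    (hA : A ∈ F) (ha : a ∈ A) : ∃ V ∈ gens F, a ∈ V ∧ V ⊆ A := by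
  obtain ⟨V, hV⟩ := (F.filter fun B => a ∈ B ∧ B ⊆ A).exists_minimal ⟨A, by simp [hA, ha]⟩
  have hVmem := mem_filter.1 hV.prop
  refine ⟨V, mem_filter.2 ⟨hVmem.1, ⟨a, hVmem.2.1⟩, fun hsup => ?_⟩, hVmem.2⟩
  have haV := hVmem.2.1
  rw [← hsup] at haV
  obtain ⟨B, hB, haB⟩ := mem_sup.1 haV
  obtain ⟨hBF, hBV⟩ := mem_filter.1 hB
  exact hBV.2 (hV.le_of_le (mem_filter.2 ⟨hBF, haB, hBV.1.trans hVmem.2.2⟩) hBV.1)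

theorem UnionClosed.sup_mem {α ι : Type*} [DecidableEq α] {F : Finset (Finset α)}
    (hF : UnionClosed F) (hempty : ∅ ∈ F) {S : Finset ι} {f : ι → Finset α}
    (hS : ∀ s ∈ S, f s ∈ F) : S.sup f ∈ F :=
  Finset.sup_mem (F : Set (Finset α)) hempty (fun A hA B hB => hF A hA B hB) S f hS

theorem piF_subset {α : Type*} [DecidableEq α] (F : Finset (Finset α)) (X : Finset α) :
    piF F X ⊆ X :=
  Finset.sup_le fun _ hA => (mem_filter.1 hA).2

theorem subset_piF {α : Type*} [DecidableEq α] {F : Finset (Finset α)} {A X : Finset α}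
    (hA : A ∈ F) (hAX : A ⊆ X) : A ⊆ piF F X :=
  le_sup (f := id) (mem_filter.2 ⟨hA, hAX⟩)

theorem UnionClosed.piF_mem {α : Type*} [DecidableEq α] {F : Finset (Finset α)}
    (hF : UnionClosed F) (hempty : ∅ ∈ F) (X : Finset α) : piF F X ∈ F :=
  hF.sup_mem hempty fun _ hA => (mem_filter.1 hA).1

theorem UnionClosed.insert_mem {α : Type*} [DecidableEq α] {F : Finset (Finset α)}
    (hF : UnionClosed F) (hempty : ∅ ∈ F) {X : Finset α} {c : α}
    (hcov : ∀ y ∈ X \ piF F X, {c, y} ∈ F) (hne : ∃ y ∈ X, {c, y} ∈ F) : insert c X ∈ F := by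
  have h := hF _ (hF.piF_mem hempty X) _
    (hF.sup_mem hempty (S := X.filter fun y => {c, y} ∈ F) (f := fun y => {c, y})
      fun y hy => (mem_filter.1 hy).2)
  convert h using 1
  ext z
  simp only [mem_insert, mem_union, mem_sup, mem_filter, mem_singleton]
  constructor
  · rintro (rfl | hz)
    · obtain ⟨y, hy, hyF⟩ := hne
      exact Or.inr ⟨y, ⟨hy, hyF⟩, Or.inl rfl⟩
    · by_cases hzp : z ∈ piF F X
      · exact Or.inl hzp
      · exact Or.inr ⟨z, ⟨hz, hcov z (mem_sdiff.2 ⟨hz, hzp⟩)⟩, Or.inr rfl⟩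
  · rintro (hz | ⟨y, ⟨hy, -⟩, rfl | rfl⟩)
    · exact Or.inr (piF_subset F X hz)
    · exact Or.inl rfl
    · exact Or.inr hy

theorem degG_pair_add_two {α : Type*} [DecidableEq α] {G : Finset (Finset α)}
    (hG : ∀ V ∈ G, #V = 2) {a b : α} (hab : a ≠ b) (hmem : {a, b} ∈ G) :
    degG G {a, b} + 2 = #{V ∈ G | a ∈ V} + #{V ∈ G | b ∈ V} := by
  have hunion : {V ∈ G | V ≠ {a, b} ∧ (V ∩ {a, b}).Nonempty} =
      ({V ∈ G | a ∈ V} ∪ {V ∈ G | b ∈ V}).erase {a, b} := by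
    ext V
    simp only [mem_filter, mem_erase, mem_union, Finset.Nonempty, mem_inter, mem_insert,
      mem_singleton]
    grind
  have hinter : ({V ∈ G | a ∈ V} ∩ {V ∈ G | b ∈ V} : Finset (Finset α)) = {{a, b}} := by
    ext V
    simp only [mem_inter, mem_filter, mem_singleton]
    constructor
    · rintro ⟨⟨hV, ha⟩, -, hb⟩
      refine (eq_of_subset_of_card_le (insert_subset ha (singleton_subset_iff.2 hb)) ?_).symm
      rw [hG V hV, card_pair hab]
    · rintro rfl
      simp [hmem]
  have hin : {a, b} ∈ ({V ∈ G | a ∈ V} ∪ {V ∈ G | b ∈ V} : Finset (Finset α)) := by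
    simp [hmem]
  have hui := card_union_add_card_inter {V ∈ G | a ∈ V} {V ∈ G | b ∈ V}
  rw [hinter, card_singleton] at hui
  have := card_erase_add_one hin
  rw [degG, hunion]
  omega

/-- If the edge `{u, x}` has at least the degree of `{u, w}`, then `x` has at least as many
neighbours outside `{u, w}` as `w` has. -/
theorem card_le_card_of_degG_le {α : Type*} [DecidableEq α] {G : Finset (Finset α)}
    (hG : ∀ V ∈ G, #V = 2) {u w x : α} (huw : u ≠ w) (hux : u ≠ x)
    (hU : {u, w} ∈ G) (hx : {u, x} ∈ G) (hwx : {w, x} ∉ G)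
    (hdeg : degG G {u, w} ≤ degG G {u, x}) {Q N : Finset α}
    (hQ : ∀ y ∈ Q, y ≠ u ∧ y ≠ w ∧ {w, y} ∈ G)
    (hN : ∀ z, z ≠ u → z ≠ w → z ≠ x → {x, z} ∈ G → z ∈ N) : #Q ≤ #N := by
  have h1 := degG_pair_add_two hG huw hU
  have h2 := degG_pair_add_two hG hux hx
  have huQ : u ∉ Q := fun h => (hQ u h).1 rfl
  have h3 : #Q + 1 ≤ #{V ∈ G | w ∈ V} := by
    rw [← card_insert_of_notMem huQ]
    refine card_le_card_of_injOn (fun y => {w, y}) ?_ ?_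
    · intro y hy
      obtain rfl | hy := mem_insert.1 (mem_coe.1 hy)
      · simpa [pair_comm] using hU
      · simpa using (hQ y hy).2.2
    · have hne : ∀ y ∈ insert u Q, y ≠ w := by
        intro y hy
        obtain rfl | hy := mem_insert.1 hy
        · exact huw
        · exact (hQ y hy).2.1
      intro y hy z hz h
      have hyz : y ∈ ({w, z} : Finset α) := by
        have : y ∈ ({w, y} : Finset α) := by simp
        rwa [show ({w, y} : Finset α) = {w, z} from h] at this
      exact (by simpa [hne y hy] using hyz)
  have h4 : #{V ∈ G | x ∈ V} ≤ #N + 1 := by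
    have hsub : {V ∈ G | x ∈ V} ⊆ (insert u N).image fun z => ({x, z} : Finset α) := by
      intro V hV
      obtain ⟨hVG, hxV⟩ := mem_filter.1 hV
      obtain ⟨z, hz⟩ := card_eq_one.1
        (show #(V.erase x) = 1 by rw [card_erase_of_mem hxV, hG V hVG])
      have hVz : {x, z} = V := by rw [← hz, insert_erase hxV]
      refine mem_image.2 ⟨z, ?_, hVz⟩
      by_cases hzu : z = u
      · exact mem_insert.2 (Or.inl hzu)
      · refine mem_insert_of_mem (hN z hzu ?_ ?_ (hVz ▸ hVG))
        · rintro rfl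
          exact hwx (by rwa [pair_comm, hVz])
        · have : z ∈ V.erase x := by simp [hz]
          exact (mem_erase.1 this).1
    exact (card_le_card hsub).trans (card_image_le.trans (card_insert_le u N))
  omega

theorem two_mul_card_superset_le {α : Type*} [DecidableEq α] {F : Finset (Finset α)}
    (hF : UnionClosed F) (hempty : ∅ ∈ F) {u w : α} {P Q : Finset α}
    {N : α → Finset α} (huw : u ≠ w) (hUF : {u, w} ∈ F)
    (hP : ∀ x, x ∈ P ↔ x ∉ ({u, w} : Finset α) ∧ {u, x} ∈ gens F ∧ {w, x} ∉ gens F)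
    (hQ : ∀ y, y ∈ Q ↔ y ∉ ({u, w} : Finset α) ∧ {w, y} ∈ gens F ∧ {u, y} ∉ gens F)
    (hN : ∀ x, ∀ z ∈ N x, z ∉ ({u, w} : Finset α) ∧ {x, z} ∈ F)
    (hPN : ∀ x ∈ P, #Q ≤ #(N x)) (hQN : ∀ y ∈ Q, #P ≤ #(N y))
    (hgraph : ∀ V ∈ gens F, (V ∩ {u, w}).Nonempty → #V ≤ 2) :
    2 * #{A ∈ F | {u, w} ⊆ A} ≤ #F := by
  set U : Finset α := {u, w} with hUdef
  have hgF : ∀ {V}, V ∈ gens F → V ∈ F := fun h => (mem_filter.1 h).1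
  let Ω := F.image (· \ U)
  have hadd : ∀ X ∈ Ω, ∀ B ∈ F, X ∪ B \ U ∈ Ω := by
    intro X hX B hB
    obtain ⟨A, hA, rfl⟩ := mem_image.1 hX
    exact mem_image.2 ⟨A ∪ B, hF A hA B hB, union_sdiff_distrib _ _ _⟩
  have hinsD : ∀ X ∈ Ω, ∀ x ∈ P ∪ Q, insert x X ∈ Ω := by
    intro X hX x hx
    obtain ⟨c, hc, hxU, hcx⟩ : ∃ c ∈ U, x ∉ U ∧ {c, x} ∈ F := by
      obtain h | h := mem_union.1 hx
      · exact ⟨u, by simp [hUdef], ((hP x).1 h).1, hgF ((hP x).1 h).2.1⟩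
      · exact ⟨w, by simp [hUdef], ((hQ x).1 h).1, hgF ((hQ x).1 h).2.1⟩
    have := hadd X hX _ hcx
    rwa [insert_sdiff_of_mem _ hc, sdiff_eq_self_of_disjoint (disjoint_singleton_left.2 hxU),
      union_comm, ← insert_eq] at this
  have hinsN : ∀ X ∈ Ω, ∀ x ∈ X, ∀ z ∈ N x, insert z X ∈ Ω := by
    intro X hX x hx z hz
    obtain ⟨hzU, hxz⟩ := hN x z hz
    have e : X ∪ {x, z} \ U = insert z X := by
      ext a
      rw [mem_union, mem_sdiff, mem_insert (a := a) (b := x), mem_singleton,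
        mem_insert (a := a) (b := z) (s := X)]
      constructor
      · rintro (h | ⟨rfl | rfl, -⟩)
        exacts [Or.inr h, Or.inr hx, Or.inl rfl]
      · rintro (rfl | h)
        exacts [Or.inr ⟨Or.inr rfl, hzU⟩, Or.inl h]
    exact e ▸ hadd X hX _ hxz
  -- Elements of `X` not covered inside `X` are joined to `u` or `w`.
  have hrem : ∀ X ∈ Ω, ∀ y ∈ X \ piF F X, {u, y} ∈ gens F ∨ {w, y} ∈ gens F := by
    intro X hX y hy
    obtain ⟨A, hA, rfl⟩ := mem_image.1 hX
    obtain ⟨hyX, hyp⟩ := mem_sdiff.1 hy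
    obtain ⟨hyA, hyU⟩ := mem_sdiff.1 hyX
    obtain ⟨V, hV, hyV, hVA⟩ := exists_mem_gens hA hyA
    obtain ⟨c, hc⟩ : (V ∩ U).Nonempty := by
      rw [nonempty_iff_ne_empty]
      intro h
      exact hyp (subset_piF (hgF hV)
        (subset_sdiff.2 ⟨hVA, disjoint_iff_inter_eq_empty.2 h⟩) hyV)
    obtain ⟨hcV, hcU⟩ := mem_inter.1 hc
    have hcy : c ≠ y := fun h => hyU (h ▸ hcU)
    have hVeq : {c, y} = V := by
      refine eq_of_subset_of_card_le (insert_subset hcV (singleton_subset_iff.2 hyV)) ?_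
      rw [card_pair hcy]
      exact hgraph V hV ⟨c, hc⟩
    rw [hUdef, mem_insert, mem_singleton] at hcU
    obtain rfl | rfl := hcU
    · exact Or.inl (hVeq ▸ hV)
    · exact Or.inr (hVeq ▸ hV)
  have huU : u ∈ U := by simp [hUdef]
  have hwU : w ∈ U := by simp [hUdef]
  have hXU : ∀ X ∈ Ω, Disjoint X U := by
    intro X hX
    obtain ⟨A, hA, rfl⟩ := mem_image.1 hX
    exact sdiff_disjoint
  let fib : Finset α → Finset (Finset α) := fun X => {A ∈ F | A \ U = X}
  have hfib : ∀ X ∈ Ω, ∀ Y ⊆ U, X ∪ Y ∈ F → X ∪ Y ∈ fib X := by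
    intro X hX Y hY h
    refine mem_filter.2 ⟨h, ?_⟩
    rw [union_sdiff_distrib, sdiff_eq_self_of_disjoint (hXU X hX), sdiff_eq_empty_iff_subset.2 hY,
      union_empty]
  have htop : ∀ X ∈ Ω, X ∪ U ∈ fib X := by
    intro X hX
    refine hfib X hX U Subset.rfl ?_
    obtain ⟨A, hA, rfl⟩ := mem_image.1 hX
    rw [sdiff_union_self_eq_union]
    exact hF A hA U hUF
  have hfibU : ∀ X ∈ Ω, ∀ c ∈ U, (∀ y ∈ X \ piF F X, {c, y} ∈ gens F) →
      (∃ y ∈ X, {c, y} ∈ gens F) → insert c X ∈ fib X := by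
    intro X hX c hc hall hex
    have h := hF.insert_mem hempty (fun y hy => hgF (hall y hy))
      (hex.imp fun y hy => ⟨hy.1, hgF hy.2⟩)
    rw [insert_eq, union_comm] at h ⊢
    exact hfib X hX _ (singleton_subset_iff.2 hc) h
  have huncov : ∀ X, ∀ y ∈ X \ piF F X, N y ∩ X = ∅ := by
    intro X y hy
    rw [← not_nonempty_iff_eq_empty]
    rintro ⟨z, hz⟩
    obtain ⟨hzN, hzX⟩ := mem_inter.1 hz
    obtain ⟨hyX, hyp⟩ := mem_sdiff.1 hy
    exact hyp (subset_piF (hN y z hzN).2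
      (insert_subset hyX (singleton_subset_iff.2 hzX)) (mem_insert_self _ _))
  let Ω' := {X ∈ Ω | (X ∩ (P ∪ Q)).Nonempty}
  let bad : Finset α → Prop := fun X =>
    (∃ x ∈ X ∩ P, N x ∩ X = ∅) ∧ ∃ y ∈ X ∩ Q, N y ∩ X = ∅
  let good : Finset α → Prop := fun X => ∀ x ∈ X ∩ (P ∪ Q), (N x ∩ X).Nonempty
  have hcompare : #(Ω'.filter bad) ≤ #(Ω'.filter good) := by
    refine card_uncovered_le_card_covered hPN hQN (fun X hX x hx => ?_) fun X hX x hx z hz => ?_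
    · obtain ⟨h1, h2⟩ := mem_filter.1 hX
      exact mem_filter.2 ⟨hinsD X h1 x hx, h2.mono (inter_subset_inter_right (subset_insert _ _))⟩
    · obtain ⟨h1, h2⟩ := mem_filter.1 hX
      exact mem_filter.2 ⟨hinsN X h1 x (mem_inter.1 hx).1 z hz,
        h2.mono (inter_subset_inter_right (subset_insert _ _))⟩
  have hpt : ∀ X ∈ Ω, 2 + (if X ∈ Ω' ∧ good X then 1 else 0) ≤
      #(fib X) + (if X ∈ Ω' ∧ bad X then 1 else 0) := by
    intro X hX
    have huX : u ∉ X := disjoint_right.1 (hXU X hX) huU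
    have hwX : w ∉ X := disjoint_right.1 (hXU X hX) hwU
    have huT : u ∈ X ∪ U := mem_union_right _ huU
    have hwT : w ∈ X ∪ U := mem_union_right _ hwU
    have huw' : u ∉ insert w X := by simp [huw, huX]
    have hwu' : w ∉ insert u X := by simp [huw.symm, hwX]
    by_cases hR : X \ piF F X = ∅
    · have hXfib : X ∈ fib X := by
        have h := hF.piF_mem hempty X
        rw [(piF_subset F X).antisymm (sdiff_eq_empty_iff_subset.1 hR)] at h
        simpa using hfib X hX ∅ (empty_subset _) (by simpa using h)
      have h2 : 1 < #(fib X) :=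
        one_lt_card.2 ⟨X, hXfib, X ∪ U, htop X hX, (ne_of_mem_of_not_mem' huT huX).symm⟩
      by_cases hX' : X ∈ Ω'
      · obtain ⟨x, hx⟩ := (mem_filter.1 hX').2
        obtain ⟨hxX, hx⟩ := mem_inter.1 hx
        have h3 : 2 < #(fib X) := by
          obtain hx | hx := mem_union.1 hx
          · exact two_lt_card.2 ⟨X, hXfib, insert u X,
              hfibU X hX u huU (by simp [hR]) ⟨x, hxX, ((hP x).1 hx).2.1⟩, X ∪ U, htop X hX,
              (ne_of_mem_of_not_mem' (mem_insert_self _ _) huX).symm,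
              (ne_of_mem_of_not_mem' huT huX).symm, (ne_of_mem_of_not_mem' hwT hwu').symm⟩
          · exact two_lt_card.2 ⟨X, hXfib, insert w X,
              hfibU X hX w hwU (by simp [hR]) ⟨x, hxX, ((hQ x).1 hx).2.1⟩, X ∪ U, htop X hX,
              (ne_of_mem_of_not_mem' (mem_insert_self _ _) hwX).symm,
              (ne_of_mem_of_not_mem' huT huX).symm, (ne_of_mem_of_not_mem' huT huw').symm⟩
        split_ifs <;> omega
      · simp only [hX', false_and, if_false]
        omega
    obtain ⟨r, hr⟩ := nonempty_iff_ne_empty.2 hR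
    have hdisj : ∀ y ∈ X \ piF F X, y ∈ X ∧ y ∉ U := fun y hy =>
      ⟨(mem_sdiff.1 hy).1, disjoint_left.1 (hXU X hX) (mem_sdiff.1 hy).1⟩
    have hPR : (¬ ∀ y ∈ X \ piF F X, {w, y} ∈ gens F) →
        ∃ x ∈ X ∩ P, N x ∩ X = ∅ := by
      intro h
      push Not at h
      obtain ⟨y, hy, hwy⟩ := h
      exact ⟨y, mem_inter.2 ⟨(hdisj y hy).1, (hP y).2 ⟨(hdisj y hy).2,
        (hrem X hX y hy).resolve_right hwy, hwy⟩⟩, huncov X y hy⟩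
    have hQR : (¬ ∀ y ∈ X \ piF F X, {u, y} ∈ gens F) →
        ∃ y ∈ X ∩ Q, N y ∩ X = ∅ := by
      intro h
      push Not at h
      obtain ⟨y, hy, huy⟩ := h
      exact ⟨y, mem_inter.2 ⟨(hdisj y hy).1, (hQ y).2 ⟨(hdisj y hy).2,
        (hrem X hX y hy).resolve_left huy, huy⟩⟩, huncov X y hy⟩
    have hPgood : (∃ x ∈ X ∩ P, N x ∩ X = ∅) → ¬ good X := by
      rintro ⟨x, hx, h⟩ hg
      have hx := mem_inter.1 hx
      exact not_nonempty_iff_eq_empty.2 h (hg x (mem_inter.2 ⟨hx.1, mem_union_left _ hx.2⟩))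
    have hQgood : (∃ x ∈ X ∩ Q, N x ∩ X = ∅) → ¬ good X := by
      rintro ⟨x, hx, h⟩ hg
      have hx := mem_inter.1 hx
      exact not_nonempty_iff_eq_empty.2 h (hg x (mem_inter.2 ⟨hx.1, mem_union_right _ hx.2⟩))
    have hrX := (hdisj r hr).1
    by_cases hu : ∀ y ∈ X \ piF F X, {u, y} ∈ gens F
    · have hufib := hfibU X hX u huU hu ⟨r, hrX, hu r hr⟩
      by_cases hw : ∀ y ∈ X \ piF F X, {w, y} ∈ gens F
      · have hwfib := hfibU X hX w hwU hw ⟨r, hrX, hw r hr⟩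
        have h3 : 2 < #(fib X) := two_lt_card.2 ⟨insert u X, hufib, insert w X, hwfib, X ∪ U,
          htop X hX, ne_of_mem_of_not_mem' (mem_insert_self _ _) huw',
          (ne_of_mem_of_not_mem' hwT hwu').symm, (ne_of_mem_of_not_mem' huT huw').symm⟩
        split_ifs <;> omega
      · have h2 : 1 < #(fib X) := one_lt_card.2 ⟨insert u X, hufib, X ∪ U, htop X hX,
          (ne_of_mem_of_not_mem' hwT hwu').symm⟩
        rw [if_neg fun h => hPgood (hPR hw) h.2]
        omega
    · rw [if_neg fun h => hQgood (hQR hu) h.2]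
      by_cases hw : ∀ y ∈ X \ piF F X, {w, y} ∈ gens F
      · have h2 : 1 < #(fib X) := one_lt_card.2 ⟨insert w X,
          hfibU X hX w hwU hw ⟨r, hrX, hw r hr⟩, X ∪ U, htop X hX,
          (ne_of_mem_of_not_mem' huT huw').symm⟩
        omega
      · have h1 : 0 < #(fib X) := card_pos.2 ⟨_, htop X hX⟩
        obtain ⟨x, hx, -⟩ := hPR hw
        have hX' : X ∈ Ω' := mem_filter.2
          ⟨hX, x, mem_inter.2 ⟨(mem_inter.1 hx).1, mem_union_left _ (mem_inter.1 hx).2⟩⟩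
        rw [if_pos ⟨hX', hPR hw, hQR hu⟩]
        omega
  have hsum := sum_le_sum hpt
  have hΩ' : ∀ p : Finset α → Prop, [DecidablePred p] →
      {X ∈ Ω | X ∈ Ω' ∧ p X} = Ω'.filter p := by
    intro p _
    ext X
    simp only [Ω', mem_filter]
    tauto
  rw [sum_add_distrib, sum_add_distrib, ← card_filter, ← card_filter, hΩ', hΩ', sum_const,
    smul_eq_mul, ← card_eq_sum_card_image] at hsum
  have hle : #{A ∈ F | U ⊆ A} ≤ #Ω := by
    refine card_le_card_of_injOn (· \ U)
      (fun A hA => mem_image_of_mem _ (mem_filter.1 hA).1) fun A hA B hB h => ?_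
    rw [← sdiff_union_of_subset (mem_filter.1 hA).2, ← sdiff_union_of_subset (mem_filter.1 hB).2]
    exact congrArg (· ∪ U) h
  omega

/-- Theorem 3.31: let `U ∈ J(F)` with `|U| = 2` and let
`G = {V ∈ J(F) : V ∩ U ≠ ∅}`. If `G` is a graph and there is a simple graph
`G' ⊆ J(F)` such that every `V ∈ G` with `|V| = 2` lies in `G'` and satisfies
`d_{G'}(V) ≥ d_{G'}(U)`, then `(F, U)` has the density property. -/
theorem stmt19 {α : Type*} [DecidableEq α] (F : Finset (Finset α))
    (hUC : UnionClosed F) (hempty : ∅ ∈ F) (U : Finset α) (hU : U ∈ gens F)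
    (hcard : U.card = 2)
    (hGgraph : ∀ V ∈ (gens F).filter (fun V => (V ∩ U).Nonempty),
      V.card = 1 ∨ V.card = 2)
    (hG' : ∃ G' ⊆ gens F, (∀ V ∈ G', V.card = 2) ∧
      ∀ V ∈ (gens F).filter (fun V => (V ∩ U).Nonempty), V.card = 2 →
        V ∈ G' ∧ degG G' U ≤ degG G' V) :
    2 * (F.filter (fun A => U ⊆ A)).card ≤ F.card := by
  obtain ⟨G', hG'J, hG'2, hdeg⟩ := hG'
  obtain ⟨u, w, huw, rfl⟩ := card_eq_two.1 hcard
  have hgF : ∀ {V}, V ∈ gens F → V ∈ F := fun h => (mem_filter.1 h).1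
  have hedge : ∀ {c x : α}, c ∈ ({u, w} : Finset α) → c ≠ x → {c, x} ∈ gens F →
      {c, x} ∈ G' ∧ degG G' {u, w} ≤ degG G' {c, x} := fun {c x} hc hcx h =>
    hdeg _ (mem_filter.2 ⟨h, c, mem_inter.2 ⟨mem_insert_self _ _, hc⟩⟩) (card_pair hcx)
  have hUG : {u, w} ∈ G' := (hedge (by simp) huw hU).1
  have hground : ∀ {V : Finset α} {z : α}, V ∈ gens F → z ∈ V → z ∈ F.sup id :=
    fun hV hz => le_sup (f := id) (hgF hV) hz
  let P := {x ∈ F.sup id | x ∉ ({u, w} : Finset α) ∧ {u, x} ∈ gens F ∧ {w, x} ∉ gens F}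
  let Q := {y ∈ F.sup id | y ∉ ({u, w} : Finset α) ∧ {w, y} ∈ gens F ∧ {u, y} ∉ gens F}
  let N : α → Finset α := fun x =>
    {z ∈ F.sup id | z ∉ ({u, w} : Finset α) ∧ {x, z} ∈ G'}
  have hP : ∀ x, x ∈ P ↔ x ∉ ({u, w} : Finset α) ∧ {u, x} ∈ gens F ∧ {w, x} ∉ gens F :=
    fun x => mem_filter.trans (and_iff_right_of_imp fun h => hground h.2.1 (by simp))
  have hQ : ∀ y, y ∈ Q ↔ y ∉ ({u, w} : Finset α) ∧ {w, y} ∈ gens F ∧ {u, y} ∉ gens F :=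
    fun y => mem_filter.trans (and_iff_right_of_imp fun h => hground h.2.1 (by simp))
  have hN : ∀ x z, z ≠ u → z ≠ w → {x, z} ∈ G' → z ∈ N x := fun x z hzu hzw hxz =>
    mem_filter.2 ⟨hground (hG'J hxz) (by simp), by simp [hzu, hzw], hxz⟩
  refine two_mul_card_superset_le hUC hempty huw (hgF hU) hP hQ (N := N) ?_ ?_ ?_ ?_
  · intro x z hz
    obtain ⟨-, hzU, hxz⟩ := mem_filter.1 hz
    exact ⟨hzU, hgF (hG'J hxz)⟩
  · intro x hx
    obtain ⟨hxU, hux, hwx⟩ := (hP x).1 hx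
    simp only [mem_insert, mem_singleton, not_or] at hxU
    obtain ⟨hmem, hle⟩ := hedge (by simp) (Ne.symm hxU.1) hux
    refine card_le_card_of_degG_le hG'2 huw (Ne.symm hxU.1) hUG hmem (fun h => hwx (hG'J h)) hle
      (fun y hy => ?_) fun z hzu hzw _ hxz => hN x z hzu hzw hxz
    obtain ⟨hyU, hwy, -⟩ := (hQ y).1 hy
    simp only [mem_insert, mem_singleton, not_or] at hyU
    exact ⟨hyU.1, hyU.2, (hedge (by simp) (Ne.symm hyU.2) hwy).1⟩
  · intro y hy
    obtain ⟨hyU, hwy, huy⟩ := (hQ y).1 hy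
    simp only [mem_insert, mem_singleton, not_or] at hyU
    obtain ⟨hmem, hle⟩ := hedge (by simp) (Ne.symm hyU.2) hwy
    rw [pair_comm u w] at hle hUG
    refine card_le_card_of_degG_le hG'2 huw.symm (Ne.symm hyU.2) hUG hmem
      (fun h => huy (hG'J h)) hle (fun x hx => ?_) fun z hzw hzu _ hyz => hN y z hzu hzw hyz
    obtain ⟨hxU, hux, -⟩ := (hP x).1 hx
    simp only [mem_insert, mem_singleton, not_or] at hxU
    exact ⟨hxU.2, hxU.1, (hedge (by simp) (Ne.symm hxU.1) hux).1⟩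
  · intro V hV hne
    have := hGgraph V (mem_filter.2 ⟨hV, hne⟩)
    omega
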